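/- Let k ≥ 1 and consider the integrality-gap instance for (1,k)-Flex-ST. Then every F ⊆ E that is feasible for (1,k)-Flex-ST for the pair (s,t) contains at least (k+1)/2 safe edges, i.e., 2·|F ∩ 𝒮| ≥ k+1; consequently the cost of F, namely ∑_{e ∈ F} c(e), is at least (k+1)²/2. -/

import Mathlib

open scoped BigOperators

/-- An edge `e` crosses the vertex set `A` if exactly one of its endpoints lies in `A`. -/
def crosses {V E : Type*} (ends : E → Sym2 V) (A : Set V) (e : E) : Prop :=
  ∃ u v : V, ends e = s(u, v) ∧ u ∈ A ∧ v ∉ A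

/-- `cut ends F A` is `δ_F(A)`: the set of edges of `F` with exactly one endpoint in `A`. -/
def cut {V E : Type*} (ends : E → Sym2 V) (F : Set E) (A : Set V) : Set E :=
  {e | e ∈ F ∧ crosses ends A e}

/-- Feasibility for `(p,q)`-Flex-ST for the pair `(s,t)`. -/
def flexSTFeasible {V E : Type*} (ends : E → Sym2 V) (𝒮 : Set E) (s t : V)
    (p q : ℕ) (F : Set E) : Prop :=
  ∀ A : Set V, s ∈ A → t ∉ A →
    p ≤ (cut ends (F ∩ 𝒮) A).ncard ∨ p + q ≤ (cut ends F A).ncard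

/-! The integrality-gap instance for `(1,k)`-Flex-ST: vertices `s`, `t`, `v₁, …, v_{k+1}`;
for each `i` two parallel unsafe edges between `s` and `vᵢ` of cost `1/2`, and one safe edge
between `vᵢ` and `t` of cost `k+1`. Edge `(i, j)` with `j ∈ {0,1}` is an unsafe `s`–`vᵢ` edge,
and `(i, 2)` is the safe `vᵢ`–`t` edge. -/

/-- Vertices of the gap instance. -/
abbrev gapV (k : ℕ) : Type := Unit ⊕ Unit ⊕ Fin (k + 1)

/-- The vertex `s`. -/
def gapS (k : ℕ) : gapV k := Sum.inl ()

/-- The vertex `t`. -/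
def gapT (k : ℕ) : gapV k := Sum.inr (Sum.inl ())

/-- The vertex `vᵢ`. -/
def gapVert (k : ℕ) (i : Fin (k + 1)) : gapV k := Sum.inr (Sum.inr i)

/-- Edges of the gap instance. -/
abbrev gapE (k : ℕ) : Type := Fin (k + 1) × Fin 3

/-- Endpoints of the edges of the gap instance. -/
def gapEnds (k : ℕ) (e : gapE k) : Sym2 (gapV k) :=
  if e.2 = 2 then s(gapVert k e.1, gapT k) else s(gapS k, gapVert k e.1)

/-- The safe edges of the gap instance. -/
def gapSafe (k : ℕ) : Set (gapE k) := {e | e.2 = 2}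

/-- The unsafe edges of the gap instance. -/
def gapUnsafe (k : ℕ) : Set (gapE k) := {e | e.2 ≠ 2}

/-- The edge costs of the gap instance. -/
noncomputable def gapCost (k : ℕ) (e : gapE k) : ℝ :=
  if e.2 = 2 then (k + 1 : ℝ) else 1 / 2

/-- The vertex `s` together with the vertices `vᵢ` whose safe edge is not in `F`. -/
def gapSide {k : ℕ} (F : Set (gapE k)) : Set (gapV k) :=
  {v | v = gapS k ∨ ∃ i, v = gapVert k i ∧ (i, 2) ∉ F}

lemma gapS_mem_gapSide {k : ℕ} (F : Set (gapE k)) : gapS k ∈ gapSide F := Or.inl rfl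

lemma gapT_notMem_gapSide {k : ℕ} (F : Set (gapE k)) : gapT k ∉ gapSide F := by
  simp [gapSide, gapS, gapT, gapVert]

lemma gapVert_mem_gapSide {k : ℕ} {F : Set (gapE k)} {i : Fin (k + 1)} :
    gapVert k i ∈ gapSide F ↔ (i, 2) ∉ F := by
  simp [gapSide, gapS, gapVert]

lemma crosses_iff_of_ends_eq {V E : Type*} {ends : E → Sym2 V} {A : Set V} {e : E} {a b : V}
    (h : ends e = s(a, b)) : crosses ends A e ↔ (a ∈ A ∧ b ∉ A) ∨ (b ∈ A ∧ a ∉ A) := by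
  simp only [crosses, h, Sym2.eq_iff]
  grind

/-- The edges of `F` crossing `gapSide F` are unsafe edges at vertices whose safe edge is in `F`. -/
lemma snd_ne_and_safe_mem_of_mem_cut_gapSide {k : ℕ} {F : Set (gapE k)} {e : gapE k}
    (he : e ∈ cut (gapEnds k) F (gapSide F)) : e.2 ≠ 2 ∧ (e.1, 2) ∈ F := by
  obtain ⟨i, j⟩ := e
  obtain ⟨heF, hcross⟩ := he
  by_cases hj : j = 2
  · subst hj
    rw [crosses_iff_of_ends_eq (a := gapVert k i) (b := gapT k) (by simp [gapEnds])] at hcross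
    have := gapT_notMem_gapSide F
    have := gapVert_mem_gapSide (F := F) (i := i)
    tauto
  · rw [crosses_iff_of_ends_eq (a := gapS k) (b := gapVert k i) (by simp [gapEnds, hj])] at hcross
    have := gapS_mem_gapSide F
    have := gapVert_mem_gapSide (F := F) (i := i)
    tauto

lemma le_two_mul_ncard_safe_of_feasible {k : ℕ} {F : Set (gapE k)}
    (hF : flexSTFeasible (gapEnds k) (gapSafe k) (gapS k) (gapT k) 1 k F) :
    k + 1 ≤ 2 * (F ∩ gapSafe k).ncard := by
  have hempty : cut (gapEnds k) (F ∩ gapSafe k) (gapSide F) = ∅ :=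
    Set.eq_empty_of_forall_notMem fun _ he =>
      (snd_ne_and_safe_mem_of_mem_cut_gapSide ⟨he.1.1, he.2⟩).1 he.1.2
  have hsub : cut (gapEnds k) F (gapSide F) ⊆
      Set.image (fun e : gapE k => (e.1, 0)) (F ∩ gapSafe k) ∪
        Set.image (fun e : gapE k => (e.1, 1)) (F ∩ gapSafe k) := by
    rintro ⟨i, j⟩ he
    obtain ⟨hj, hi⟩ := snd_ne_and_safe_mem_of_mem_cut_gapSide he
    have hmem : (i, 2) ∈ F ∩ gapSafe k := ⟨hi, rfl⟩
    fin_cases j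
    · exact Or.inl ⟨_, hmem, rfl⟩
    · exact Or.inr ⟨_, hmem, rfl⟩
    · exact absurd rfl hj
  have hcut : 1 + k ≤ (cut (gapEnds k) F (gapSide F)).ncard := by
    simpa [hempty] using hF _ (gapS_mem_gapSide F) (gapT_notMem_gapSide F)
  have hle := (Set.ncard_le_ncard hsub).trans (Set.ncard_union_le _ _)
  have himage₀ := Set.ncard_image_le (f := fun e : gapE k => (e.1, (0 : Fin 3)))
    (F ∩ gapSafe k).toFinite
  have himage₁ := Set.ncard_image_le (f := fun e : gapE k => (e.1, (1 : Fin 3)))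
    (F ∩ gapSafe k).toFinite
  omega

lemma ncard_safe_mul_le_cost {k : ℕ} (F : Set (gapE k)) :
    ((F ∩ gapSafe k).ncard : ℝ) * (k + 1) ≤ ∑ᶠ e ∈ F, gapCost k e := by
  classical
  rw [finsum_mem_eq_finite_toFinset_sum _ F.toFinite,
    Set.ncard_eq_toFinset_card _ (F ∩ gapSafe k).toFinite, ← nsmul_eq_mul, ← Finset.sum_const]
  calc ∑ _e ∈ (F ∩ gapSafe k).toFinite.toFinset, (k + 1 : ℝ)
      = ∑ e ∈ (F ∩ gapSafe k).toFinite.toFinset, gapCost k e := by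
        refine Finset.sum_congr rfl fun e he => ?_
        have he2 : e.2 = 2 := ((Set.Finite.mem_toFinset _).1 he).2
        simp [gapCost, he2]
    _ ≤ _ := by
        refine Finset.sum_le_sum_of_subset_of_nonneg
          (Set.Finite.toFinset_mono Set.inter_subset_left) fun e _ _ => ?_
        unfold gapCost
        split_ifs <;> positivity

theorem stmt16 (k : ℕ) (hk : 1 ≤ k) (F : Set (gapE k))
    (hF : flexSTFeasible (gapEnds k) (gapSafe k) (gapS k) (gapT k) 1 k F) :
    k + 1 ≤ 2 * (F ∩ gapSafe k).ncard ∧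
    ((k + 1 : ℝ) ^ 2 / 2 ≤ ∑ᶠ e ∈ F, gapCost k e) := by
  have hsafe := le_two_mul_ncard_safe_of_feasible hF
  refine ⟨hsafe, ?_⟩
  have hcost := ncard_safe_mul_le_cost F
  have hsafeReal : (k + 1 : ℝ) ≤ 2 * ((F ∩ gapSafe k).ncard : ℝ) := by exact_mod_cast hsafe
  nlinarith [(k.cast_nonneg : (0 : ℝ) ≤ k)]
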